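/- For every Λ ∈ L^H and every Hermitian direction δΛ, the directional (Gâteaux) derivative of J_Ψ at Λ in direction δΛ exists and equals δJ_Ψ(Λ; δΛ) = ⟨ I − ∫ G Q_Λ^{-1} Ψ Q_Λ^{-1} G*, δΛ ⟩, where ⟨A,B⟩ = tr(AB*). -/

import Mathlib

open Matrix MeasureTheory
open scoped ComplexOrder

/-- Entrywise integral over the unit circle, `∫_{-π}^{π} F(e^{jθ}) dθ/2π`. -/
noncomputable def circleIntM {n m : ℕ} (F : ℝ → Matrix (Fin n) (Fin m) ℂ) :
    Matrix (Fin n) (Fin m) ℂ :=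
  Matrix.of fun i j => (2 * (Real.pi : ℂ))⁻¹ * ∫ θ in (-Real.pi)..Real.pi, F θ i j

/-- The transfer function `G(z) = (zI - A)⁻¹ B` evaluated at `z = e^{jθ}`. -/
noncomputable def Gfun {n m : ℕ} (A : Matrix (Fin n) (Fin n) ℂ)
    (B : Matrix (Fin n) (Fin m) ℂ) (θ : ℝ) : Matrix (Fin n) (Fin m) ℂ :=
  (Complex.exp (θ * Complex.I) • (1 : Matrix (Fin n) (Fin n) ℂ) - A)⁻¹ * B

/-- The pair `(A, B)` is reachable: the controllability matrix
`[B, AB, ..., A^{n-1}B]` has rank `n`. -/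
noncomputable def IsReachable {n m : ℕ} (A : Matrix (Fin n) (Fin n) ℂ)
    (B : Matrix (Fin n) (Fin m) ℂ) : Prop :=
  (Matrix.of fun (i : Fin n) (p : Fin n × Fin m) => (A ^ (p.1 : ℕ) * B) i p.2).rank = n

/-- `Q_Λ(e^{jθ}) = I + G(e^{jθ})* Λ G(e^{jθ})`. -/
noncomputable def Qfun {n m : ℕ} (A : Matrix (Fin n) (Fin n) ℂ)
    (B : Matrix (Fin n) (Fin m) ℂ) (Λ : Matrix (Fin n) (Fin n) ℂ) (θ : ℝ) :
    Matrix (Fin m) (Fin m) ℂ :=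
  (1 : Matrix (Fin m) (Fin m) ℂ) + (Gfun A B θ)ᴴ * Λ * Gfun A B θ

/-- The dual functional `J_Ψ(Λ) = tr ∫ Q_Λ⁻¹ Ψ + tr Λ` (a real number). -/
noncomputable def Jfun {n m : ℕ} (A : Matrix (Fin n) (Fin n) ℂ)
    (B : Matrix (Fin n) (Fin m) ℂ) (Ψ : ℝ → Matrix (Fin m) (Fin m) ℂ)
    (Λ : Matrix (Fin n) (Fin n) ℂ) : ℝ :=
  ((circleIntM fun θ => (Qfun A B Λ θ)⁻¹ * Ψ θ).trace + Λ.trace).re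

theorem LinearMap.hasDerivAt_ringInverse_add_smul_mul {R : Type*} [NormedRing R]
    [NormedAlgebra ℝ R] [CompleteSpace R] (L : R →ₗ[ℝ] ℂ) (hL : Continuous L) (M N P : R)
    (s : ℝ) (h : IsUnit (M + s • N)) :
    HasDerivAt (fun t : ℝ => L (Ring.inverse (M + t • N) * P))
      (-L (Ring.inverse (M + s • N) * N * Ring.inverse (M + s • N) * P)) s := by
  have hline : HasDerivAt (fun t : ℝ => M + t • N) N s :=
    (((hasDerivAt_id' s).smul_const N).const_add M).congr_deriv (one_smul ℝ N)
  obtain ⟨u, hu⟩ := h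
  have hinv := hasFDerivAt_ringInverse (𝕜 := ℝ) u
  rw [hu] at hinv
  have hmul := (hinv.comp_hasDerivAt s hline).mul_const P
  have hentry := (ContinuousLinearMap.mk L hL).hasFDerivAt.comp_hasDerivAt s hmul
  refine hentry.congr_deriv ?_
  simp [← hu]

theorem Matrix.hasDerivAt_inv_add_smul_mul_apply {m : ℕ} (M N P : Matrix (Fin m) (Fin m) ℂ)
    (s : ℝ) (h : IsUnit (M + s • N)) (i j : Fin m) :
    HasDerivAt (fun t : ℝ => ((M + t • N)⁻¹ * P) i j)
      (-((M + s • N)⁻¹ * N * (M + s • N)⁻¹ * P) i j) s := by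
  simp only [Matrix.nonsing_inv_eq_ringInverse]
  let : NormedRing (Matrix (Fin m) (Fin m) ℂ) := Matrix.linftyOpNormedRing
  let : NormedAlgebra ℝ (Matrix (Fin m) (Fin m) ℂ) := Matrix.linftyOpNormedAlgebra
  have hcomplete : CompleteSpace (Matrix (Fin m) (Fin m) ℂ) :=
    FiniteDimensional.complete ℝ _
  exact LinearMap.hasDerivAt_ringInverse_add_smul_mul
    (Matrix.entryLinearMap ℝ ℂ i j) (continuous_id.matrix_elem i j) M N P s h

theorem Continuous.continuousOn_matrix_inv {X : Type*} [TopologicalSpace X] {m : ℕ}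
    {f : X → Matrix (Fin m) (Fin m) ℂ} (hf : Continuous f) :
    ContinuousOn (fun x => (f x)⁻¹) {x | IsUnit (f x)} := by
  simp only [Matrix.inv_def, Ring.inverse_eq_inv']
  refine ContinuousOn.smul (hf.matrix_det.continuousOn.inv₀ fun x hx => ?_)
    hf.matrix_adjugate.continuousOn
  exact ((Matrix.isUnit_iff_isUnit_det _).1 hx).ne_zero

theorem Continuous.isOpen_isUnit_matrix {X : Type*} [TopologicalSpace X] {m : ℕ}
    {f : X → Matrix (Fin m) (Fin m) ℂ} (hf : Continuous f) : IsOpen {x | IsUnit (f x)} := by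
  simp only [Matrix.isUnit_iff_isUnit_det, isUnit_iff_ne_zero]
  exact isOpen_ne_fun hf.matrix_det continuous_const

theorem hasDerivAt_integral_inv_add_smul_mul_apply {m : ℕ}
    {M N P : ℝ → Matrix (Fin m) (Fin m) ℂ} (hM : Continuous M) (hN : Continuous N)
    (hP : Continuous P) (hu : ∀ θ, IsUnit (M θ)) (a b : ℝ) (i j : Fin m) :
    HasDerivAt (fun t : ℝ => ∫ θ in a..b, ((M θ + t • N θ)⁻¹ * P θ) i j)
      (∫ θ in a..b, -((M θ)⁻¹ * N θ * (M θ)⁻¹ * P θ) i j) 0 := by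
  set F : ℝ × ℝ → Matrix (Fin m) (Fin m) ℂ := fun p => M p.2 + p.1 • N p.2 with hF
  have hFc : Continuous F := by fun_prop
  obtain ⟨U, V, hU, -, h0U, hV, hUV⟩ := generalized_tube_lemma (isCompact_singleton (x := (0 : ℝ)))
    (isCompact_uIcc (a := a) (b := b)) hFc.isOpen_isUnit_matrix (by
      rintro ⟨t, θ⟩ ⟨rfl, -⟩
      simpa [hF] using hu θ)
  obtain ⟨ε, hε, hεU⟩ := Metric.nhds_basis_closedBall.mem_iff.1 (hU.mem_nhds (h0U rfl))
  have hunit : Metric.closedBall (0 : ℝ) ε ×ˢ Set.uIcc a b ⊆ {p | IsUnit (F p)} :=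
    (Set.prod_mono hεU hV).trans hUV
  have hinv := hFc.continuousOn_matrix_inv.mono hunit
  have hPc : Continuous fun p : ℝ × ℝ => P p.2 := by fun_prop
  have hNc : Continuous fun p : ℝ × ℝ => N p.2 := by fun_prop
  have hf : ContinuousOn (fun p => ((F p)⁻¹ * P p.2) i j)
      (Metric.closedBall (0 : ℝ) ε ×ˢ Set.uIcc a b) :=
    (continuous_id.matrix_elem i j).comp_continuousOn (hinv.mul hPc.continuousOn)
  have hf' : ContinuousOn (fun p => -((F p)⁻¹ * N p.2 * (F p)⁻¹ * P p.2) i j)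
      (Metric.closedBall (0 : ℝ) ε ×ˢ Set.uIcc a b) :=
    ((continuous_id.matrix_elem i j).comp_continuousOn
      (((hinv.mul hNc.continuousOn).mul hinv).mul hPc.continuousOn)).neg
  obtain ⟨C, hC⟩ :=
    ((isCompact_closedBall (0 : ℝ) ε).prod isCompact_uIcc).exists_bound_of_continuousOn hf'
  have slice {g : ℝ × ℝ → ℂ}
      (hg : ContinuousOn g (Metric.closedBall (0 : ℝ) ε ×ˢ Set.uIcc a b))
      {t : ℝ} (ht : t ∈ Metric.closedBall (0 : ℝ) ε) :
      IntervalIntegrable (fun θ => g (t, θ)) volume a b :=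
    (hg.comp (f := fun θ => (t, θ)) (by fun_prop) fun θ hθ => ⟨ht, hθ⟩).intervalIntegrable
  have h0 : (0 : ℝ) ∈ Metric.closedBall (0 : ℝ) ε := Metric.mem_closedBall_self hε.le
  have key := intervalIntegral.hasDerivAt_integral_of_dominated_loc_of_deriv_le
    (F := fun t θ => ((F (t, θ))⁻¹ * P θ) i j)
    (F' := fun t θ => -((F (t, θ))⁻¹ * N θ * (F (t, θ))⁻¹ * P θ) i j)
    (μ := volume) (a := a) (b := b) (bound := fun _ => C)
    (Metric.closedBall_mem_nhds (0 : ℝ) hε)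
    (Filter.eventually_of_mem (Metric.closedBall_mem_nhds (0 : ℝ) hε) fun t ht =>
      (slice hf ht).def'.aestronglyMeasurable)
    (slice hf h0) (slice hf' h0).def'.aestronglyMeasurable
    (ae_of_all _ fun θ hθ t ht => hC (t, θ) ⟨ht, Set.uIoc_subset_uIcc hθ⟩)
    intervalIntegrable_const
    (ae_of_all _ fun θ hθ t ht => Matrix.hasDerivAt_inv_add_smul_mul_apply _ _ _ _
      (hunit (a := (t, θ)) ⟨ht, Set.uIoc_subset_uIcc hθ⟩) i j)
  simpa [hF] using key.2

theorem continuous_Gfun {n m : ℕ} {A : Matrix (Fin n) (Fin n) ℂ} (B : Matrix (Fin n) (Fin m) ℂ)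
    (hA : ∀ z ∈ spectrum ℂ A, ‖z‖ < 1) : Continuous (Gfun A B) := by
  have hres : ∀ θ : ℝ,
      IsUnit (Complex.exp (θ * Complex.I) • (1 : Matrix (Fin n) (Fin n) ℂ) - A) := by
    intro θ
    by_contra h
    have := hA (Complex.exp (θ * Complex.I)) (by
      rwa [spectrum.mem_iff, Algebra.algebraMap_eq_smul_one])
    simp [Complex.norm_exp_ofReal_mul_I] at this
  have hc : Continuous fun θ : ℝ =>
      Complex.exp (θ * Complex.I) • (1 : Matrix (Fin n) (Fin n) ℂ) - A := by fun_prop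
  have hinv := hc.continuousOn_matrix_inv
  simp only [hres, Set.ofPred_true, continuousOn_univ] at hinv
  exact hinv.matrix_mul continuous_const

theorem circleIntM_trace {n : ℕ} (F : ℝ → Matrix (Fin n) (Fin n) ℂ) :
    (circleIntM F).trace =
      (2 * (Real.pi : ℂ))⁻¹ * ∑ i, ∫ θ in (-Real.pi)..Real.pi, F θ i i := by
  simp [Matrix.trace, circleIntM, Finset.mul_sum]

theorem circleIntM_mul_const {n m k : ℕ} {F : ℝ → Matrix (Fin n) (Fin m) ℂ} (hF : Continuous F)
    (D : Matrix (Fin m) (Fin k) ℂ) : circleIntM F * D = circleIntM fun θ => F θ * D := by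
  ext i j
  simp only [circleIntM, Matrix.mul_apply, Matrix.of_apply]
  rw [intervalIntegral.integral_finsetSum (f := fun l θ => F θ i l * D l j) fun l _ =>
    ((hF.matrix_elem i l).mul continuous_const).intervalIntegrable _ _]
  simp [Finset.mul_sum, mul_assoc]

theorem circleIntM_trace_of_continuous {n : ℕ} {F : ℝ → Matrix (Fin n) (Fin n) ℂ}
    (hF : Continuous F) : (circleIntM F).trace =
      (2 * (Real.pi : ℂ))⁻¹ * ∫ θ in (-Real.pi)..Real.pi, (F θ).trace := by
  rw [circleIntM_trace]
  simp only [Matrix.trace, Matrix.diag]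
  rw [intervalIntegral.integral_finsetSum fun l _ =>
    (hF.matrix_elem l l).intervalIntegrable _ _]

theorem Qfun_add_smul {n m : ℕ} (A : Matrix (Fin n) (Fin n) ℂ) (B : Matrix (Fin n) (Fin m) ℂ)
    (Λ δΛ : Matrix (Fin n) (Fin n) ℂ) (t θ : ℝ) :
    Qfun A B (Λ + t • δΛ) θ =
      Qfun A B Λ θ + t • ((Gfun A B θ)ᴴ * δΛ * Gfun A B θ) := by
  simp [Qfun, Matrix.mul_add, Matrix.add_mul, add_assoc]

theorem stmt7 {n m : ℕ} (A : Matrix (Fin n) (Fin n) ℂ) (B : Matrix (Fin n) (Fin m) ℂ)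
    (hA : ∀ z ∈ spectrum ℂ A, ‖z‖ < 1) (hB : B.rank = m) (hAB : IsReachable A B)
    (Ψ : ℝ → Matrix (Fin m) (Fin m) ℂ) (hΨc : Continuous Ψ)
    (hΨper : Function.Periodic Ψ (2 * Real.pi)) (hΨpd : ∀ θ : ℝ, (Ψ θ).PosDef)
    (Λ : Matrix (Fin n) (Fin n) ℂ) (hΛ : Λ.IsHermitian)
    (hQ : ∀ θ : ℝ, (Qfun A B Λ θ).PosDef)
    (δΛ : Matrix (Fin n) (Fin n) ℂ) (hδΛ : δΛ.IsHermitian) :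
    HasDerivAt (fun t : ℝ => Jfun A B Ψ (Λ + t • δΛ))
      ((Matrix.trace
          (((1 : Matrix (Fin n) (Fin n) ℂ) -
            circleIntM fun θ =>
              Gfun A B θ * (Qfun A B Λ θ)⁻¹ * Ψ θ * (Qfun A B Λ θ)⁻¹ * (Gfun A B θ)ᴴ) *
            δΛᴴ)).re)
      0 := by
  have hG := continuous_Gfun B hA
  have hGH : Continuous fun θ => (Gfun A B θ)ᴴ := hG.matrix_conjTranspose
  have hQc : Continuous (Qfun A B Λ) :=
    continuous_const.add ((hGH.matrix_mul continuous_const).matrix_mul hG)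
  have hQu : ∀ θ, IsUnit (Qfun A B Λ θ) := fun θ => (hQ θ).isUnit
  have hQi : Continuous fun θ => (Qfun A B Λ θ)⁻¹ := by
    have := hQc.continuousOn_matrix_inv
    simpa only [hQu, Set.ofPred_true, continuousOn_univ] using this
  have hN : Continuous fun θ => (Gfun A B θ)ᴴ * δΛ * Gfun A B θ :=
    (hGH.matrix_mul continuous_const).matrix_mul hG
  have hint := HasDerivAt.fun_sum (u := Finset.univ) fun i _ =>
    hasDerivAt_integral_inv_add_smul_mul_apply hQc hN hΨc hQu (-Real.pi) Real.pi i i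
  have htr : HasDerivAt (fun t : ℝ => (Λ + t • δΛ).trace) δΛ.trace 0 := by
    simpa [Matrix.trace_add, Matrix.trace_smul] using
      (((hasDerivAt_id (0 : ℝ)).smul_const δΛ.trace).const_add Λ.trace)
  have hre := Complex.reCLM.hasFDerivAt.comp_hasDerivAt (0 : ℝ)
    ((hint.const_mul (2 * (Real.pi : ℂ))⁻¹).fun_add htr)
  have hfun : (fun t : ℝ => Jfun A B Ψ (Λ + t • δΛ)) = fun t : ℝ => Complex.reCLM
      ((2 * (Real.pi : ℂ))⁻¹ * (∑ i, ∫ θ in (-Real.pi)..Real.pi,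
        ((Qfun A B Λ θ + t • ((Gfun A B θ)ᴴ * δΛ * Gfun A B θ))⁻¹ * Ψ θ) i i) +
          (Λ + t • δΛ).trace) := by
    ext t
    simp only [Jfun, circleIntM_trace, Qfun_add_smul, Complex.reCLM_apply]
  rw [hfun]
  refine hre.congr_deriv ?_
  rw [Complex.reCLM_apply]
  congr 1
  have hR : Continuous fun θ =>
      Gfun A B θ * (Qfun A B Λ θ)⁻¹ * Ψ θ * (Qfun A B Λ θ)⁻¹ * (Gfun A B θ)ᴴ :=
    (((hG.matrix_mul hQi).matrix_mul hΨc).matrix_mul hQi).matrix_mul hGH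
  have hL : Continuous fun θ =>
      (Qfun A B Λ θ)⁻¹ * ((Gfun A B θ)ᴴ * δΛ * Gfun A B θ) * (Qfun A B Λ θ)⁻¹ * Ψ θ :=
    ((hQi.matrix_mul hN).matrix_mul hQi).matrix_mul hΨc
  have hcyc : ∀ θ, ((Qfun A B Λ θ)⁻¹ * ((Gfun A B θ)ᴴ * δΛ * Gfun A B θ) *
      (Qfun A B Λ θ)⁻¹ * Ψ θ).trace = (Gfun A B θ * (Qfun A B Λ θ)⁻¹ * Ψ θ *
        (Qfun A B Λ θ)⁻¹ * (Gfun A B θ)ᴴ * δΛ).trace := fun θ => by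
    simpa only [Matrix.mul_assoc] using Matrix.trace_mul_comm
      ((Qfun A B Λ θ)⁻¹ * (Gfun A B θ)ᴴ * δΛ) (Gfun A B θ * (Qfun A B Λ θ)⁻¹ * Ψ θ)
  rw [hδΛ.eq, Matrix.sub_mul, Matrix.one_mul, Matrix.trace_sub, circleIntM_mul_const hR,
    circleIntM_trace_of_continuous (hR.matrix_mul continuous_const)]
  simp only [← hcyc, intervalIntegral.integral_neg, Finset.sum_neg_distrib]
  rw [mul_neg, ← circleIntM_trace_of_continuous hL, circleIntM_trace]
  ring
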